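/- arXiv:2410.15818 — 3 statements merged into one kernel-verified Lean document; each statement's English description precedes it below -/
import Mathlib

section
/- Let (Ω, F, P) be a probability space, T > 0, κ ∈ ℝ, R ∈ ℝ, and let ι : Ω → ℝ be integrable. For each jointly measurable control γ : [0,T] × Ω → ℝ with E[∫₀ᵀ γ(t,·)² dt] < ∞, define Ĵ∞(γ) := E[ −R + e^{κT} ι + ∫₀ᵀ e^{κ(T−t)} γ(t,·) dt − (1/2) ∫₀ᵀ γ(t,·)² dt ]. Then the supremum of Ĵ∞(γ) over all such γ equals −R + e^{κT} E[ι] + (1/2) ∫₀ᵀ e^{2κ(T−t)} dt, and it is attained by the deterministic control γ̂(t, ω) := e^{κ(T−t)}. -/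
open MeasureTheory

/-- A product of two measurable functions with integrable squares is integrable. -/
theorem integrable_mul_of_integrable_sq {α : Type*} [MeasurableSpace α] {μ : Measure α}
    {f g : α → ℝ} (hf : AEStronglyMeasurable f μ) (hg : AEStronglyMeasurable g μ)
    (hf2 : Integrable (fun x => f x ^ 2) μ) (hg2 : Integrable (fun x => g x ^ 2) μ) :
    Integrable (fun x => f x * g x) μ :=
  ((memLp_two_iff_integrable_sq hf).2 hf2).integrable_mul
    ((memLp_two_iff_integrable_sq hg).2 hg2)

/-- Integrated form of `h * g - g ^ 2 / 2 ≤ h ^ 2 / 2`. -/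
theorem integral_mul_sub_half_integral_sq_le {α : Type*} [MeasurableSpace α] {μ : Measure α}
    {h g : α → ℝ} (hh : Integrable (fun x => h x ^ 2) μ) (hg : Integrable (fun x => g x ^ 2) μ)
    (hhg : Integrable (fun x => h x * g x) μ) :
    (∫ x, h x * g x ∂μ) - (1 / 2) * ∫ x, g x ^ 2 ∂μ ≤ (1 / 2) * ∫ x, h x ^ 2 ∂μ := by
  rw [← integral_const_mul, ← integral_const_mul, ← integral_sub hhg (hg.const_mul _)]
  exact integral_mono (hhg.sub (hg.const_mul _)) (hh.const_mul _)
    fun x => by dsimp only; nlinarith [sq_nonneg (h x - g x)]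

theorem integral_const_add_const_mul_add_const {Ω : Type*} [MeasurableSpace Ω]
    {P : Measure Ω} [IsProbabilityMeasure P] {ι : Ω → ℝ} (hι : Integrable ι P) (a b c : ℝ) :
    ∫ ω, (a + b * ι ω + c) ∂P = a + b * (∫ ω, ι ω ∂P) + c := by
  have hab : Integrable (fun ω => a + b * ι ω) P := (integrable_const a).add (hι.const_mul b)
  rw [integral_add hab (integrable_const c),
    integral_add (integrable_const a) (hι.const_mul b), integral_const_mul]
  simp

/-- Value `V̂^∞` of the untruncated limiting McKean–Vlasov control problem in the
multitask Principal–Agent example: the supremum of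
`Ĵ∞(γ) = E[−R + e^{κT} ι + ∫₀ᵀ e^{κ(T−t)} γ(t,·) dt − (1/2)∫₀ᵀ γ(t,·)² dt]`
over jointly measurable square-integrable controls equals
`−R + e^{κT} E[ι] + (1/2)∫₀ᵀ e^{2κ(T−t)} dt`, attained at the deterministic
control `γ̂(t,ω) = e^{κ(T−t)}`. -/
theorem stmt1 {Ω : Type*} [MeasurableSpace Ω] (P : Measure Ω) [IsProbabilityMeasure P]
    (T κ R : ℝ) (hT : 0 < T) (ι : Ω → ℝ) (hι : Integrable ι P) :
    IsGreatest
      {v : ℝ | ∃ γ : ℝ → Ω → ℝ,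
        Measurable (Function.uncurry γ) ∧
        Integrable (fun q : ℝ × Ω => (γ q.1 q.2) ^ 2)
          (((volume : Measure ℝ).restrict (Set.Ioc 0 T)).prod P) ∧
        v = ∫ ω, (-R + Real.exp (κ * T) * ι ω
              + (∫ t in Set.Ioc 0 T, Real.exp (κ * (T - t)) * γ t ω)
              - (1 / 2) * ∫ t in Set.Ioc 0 T, (γ t ω) ^ 2) ∂P}
      (-R + Real.exp (κ * T) * (∫ ω, ι ω ∂P)
        + (1 / 2) * ∫ t in Set.Ioc 0 T, Real.exp (2 * κ * (T - t)))
    ∧ (∫ ω, (-R + Real.exp (κ * T) * ι ω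
          + (∫ t in Set.Ioc 0 T, Real.exp (κ * (T - t)) * Real.exp (κ * (T - t)))
          - (1 / 2) * ∫ t in Set.Ioc 0 T, (Real.exp (κ * (T - t))) ^ 2) ∂P)
        = -R + Real.exp (κ * T) * (∫ ω, ι ω ∂P)
          + (1 / 2) * ∫ t in Set.Ioc 0 T, Real.exp (2 * κ * (T - t)) := by
  have hexp (t : ℝ) : Real.exp (κ * (T - t)) ^ 2 = Real.exp (2 * κ * (T - t)) := by
    rw [← Real.exp_nat_mul]; congr 1; push_cast; ring
  have hcont : Continuous fun t : ℝ => Real.exp (κ * (T - t)) := by fun_prop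
  have hint : Integrable (fun t : ℝ => Real.exp (κ * (T - t)) ^ 2)
      (volume.restrict (Set.Ioc 0 T)) := (hcont.pow 2).integrableOn_Ioc
  have hval : (∫ ω, (-R + Real.exp (κ * T) * ι ω
          + (∫ t in Set.Ioc 0 T, Real.exp (κ * (T - t)) * Real.exp (κ * (T - t)))
          - (1 / 2) * ∫ t in Set.Ioc 0 T, (Real.exp (κ * (T - t))) ^ 2) ∂P)
        = -R + Real.exp (κ * T) * (∫ ω, ι ω ∂P)
          + (1 / 2) * ∫ t in Set.Ioc 0 T, Real.exp (2 * κ * (T - t)) := by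
    simp only [← sq, hexp]
    rw [← integral_const_add_const_mul_add_const hι]
    congr 1
    funext ω
    ring
  refine ⟨⟨⟨fun t _ => Real.exp (κ * (T - t)), ?_, hint.comp_fst P, hval.symm⟩, ?_⟩, hval⟩
  · exact hcont.measurable.comp measurable_fst
  rintro v ⟨γ, hγ, hγ2, rfl⟩
  have hmul : Integrable (fun q : ℝ × Ω => Real.exp (κ * (T - q.1)) * γ q.1 q.2)
      (((volume : Measure ℝ).restrict (Set.Ioc 0 T)).prod P) :=
    integrable_mul_of_integrable_sq
      (hcont.measurable.comp measurable_fst).aestronglyMeasurable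
      hγ.aestronglyMeasurable (hint.comp_fst P) hγ2
  simp only [← hexp]
  rw [← integral_const_add_const_mul_add_const hι]
  refine integral_mono_ae
    ((((integrable_const _).add (hι.const_mul _)).add hmul.integral_prod_right).sub
      (hγ2.integral_prod_right.const_mul _))
    (((integrable_const _).add (hι.const_mul _)).add (integrable_const _)) ?_
  filter_upwards [hγ2.prod_left_ae, hmul.prod_left_ae] with ω h2 h1
  have := integral_mul_sub_half_integral_sq_le hint h2 h1
  linarith
end

section
/- Let T > 0, κ ∈ ℝ, b̄ > 0, and define the clamp b_{b̄}(u) := max(−b̄, min(b̄, u)) for u ∈ ℝ. Let x₀ ∈ ℝ, let g : [0,T] → ℝ be Lebesgue integrable, let w : [0,T] → ℝ be any function, and let x, y : [0,T] → ℝ be continuous and satisfy, for all t ∈ [0,T], x(t) = x₀ + ∫₀ᵗ ( g(s) + κ b_{b̄}(x(s)) ) ds + w(t) and y(t) = x₀ + ∫₀ᵗ ( g(s) + κ y(s) ) ds + w(t). Then sup_{t ∈ [0,T]} |x(t) − y(t)| ≤ |κ| e^{|κ| T} ∫₀ᵀ |y(s)|·1_{\{|y(s)| > b̄\}} ds. Moreover,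 if ∫₀ᵀ y(s)² ds ≤ M for some M ≥ 0, then sup_{t ∈ [0,T]} |x(t) − y(t)| ≤ |κ| e^{|κ| T} M / b̄. -/
open MeasureTheory intervalIntegral

/-- Integral form of Grönwall's inequality, with constant data. -/
theorem le_mul_exp_of_le_add_mul_integral {T C K : ℝ} (hK : 0 ≤ K) {u : ℝ → ℝ}
    (hu : ContinuousOn u (Set.Icc 0 T))
    (h : ∀ t ∈ Set.Icc 0 T, u t ≤ C + K * ∫ s in (0:ℝ)..t, u s) :
    ∀ t ∈ Set.Icc 0 T, u t ≤ C * Real.exp (K * t) := by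
  intro t ht
  have hT : 0 ≤ T := ht.1.trans ht.2
  have hint : ∀ r ∈ Set.Icc 0 T, IntervalIntegrable u volume 0 r := fun r hr =>
    (hu.mono (Set.Icc_subset_Icc_right hr.2)).intervalIntegrable_of_Icc hr.1
  have hcont : ContinuousOn (fun r => C + K * ∫ s in (0:ℝ)..r, u s) (Set.Icc 0 T) := by
    have := continuousOn_primitive_interval (μ := volume) (f := u) (a := 0) (b := T)
      (by simpa [Set.uIcc_of_le hT] using hu.integrableOn_Icc)
    rw [Set.uIcc_of_le hT] at this
    exact continuousOn_const.add (continuousOn_const.mul this)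
  have hderiv : ∀ r ∈ Set.Ico 0 T,
      HasDerivWithinAt (fun r => C + K * ∫ s in (0:ℝ)..r, u s) (K * u r) (Set.Ici r) r := by
    intro r hr
    have hnhds : Set.Icc 0 T ∈ nhdsWithin r (Set.Ioi r) :=
      Filter.mem_of_superset (Ioc_mem_nhdsGT hr.2)
        fun z hz => ⟨hr.1.trans hz.1.le, hz.2⟩
    have hcr : ContinuousWithinAt u (Set.Ioi r) r :=
      (hu r ⟨hr.1, hr.2.le⟩).mono_of_mem_nhdsWithin hnhds
    have hmeas : StronglyMeasurableAtFilter u (nhdsWithin r (Set.Ioi r)) volume :=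
      ⟨_, hnhds, hu.aestronglyMeasurable measurableSet_Icc⟩
    exact ((integral_hasDerivWithinAt_right (hint r ⟨hr.1, hr.2.le⟩) hmeas hcr).const_mul
      K).const_add C
  have hbound := le_gronwallBound_of_liminf_deriv_right_le (δ := C) (K := K) (ε := 0) hcont
    (fun r hr z hz => (hderiv r hr).liminf_right_slope_le hz) (by simp)
    (fun r hr => by simpa using mul_le_mul_of_nonneg_left (h r ⟨hr.1, hr.2.le⟩) hK) t ht
  rw [gronwallBound_ε0, sub_zero] at hbound
  exact (h t ht).trans hbound

/-- The distance from the clamp of `u` to `v` exceeds `|u - v|` by at most `|v|`, and only when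
`v` lies outside `[-b, b]`. -/
theorem abs_clamp_sub_le {b : ℝ} (hb : 0 < b) (u v : ℝ) :
    |max (-b) (min b u) - v| ≤ |u - v| + if b < |v| then |v| else 0 := by
  split_ifs <;> grind

theorem integrableOn_tail {T b : ℝ} {y : ℝ → ℝ} (hy : ContinuousOn y (Set.Icc 0 T)) :
    IntegrableOn (fun s => if b < |y s| then |y s| else 0) (Set.Ioc 0 T) := by
  have hyi : IntegrableOn y (Set.Ioc 0 T) :=
    hy.integrableOn_Icc.mono_set Set.Ioc_subset_Icc_self
  have hF : Measurable fun v : ℝ => if b < |v| then |v| else 0 :=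
    Measurable.ite (measurableSet_lt measurable_const measurable_id.abs)
      measurable_id.abs measurable_const
  refine Integrable.mono hyi
    (hF.comp_aemeasurable hyi.aestronglyMeasurable.aemeasurable).aestronglyMeasurable
    (Filter.Eventually.of_forall fun s => ?_)
  split_ifs <;> simp

/-- Truncation-stability (Gronwall) estimate for the clamped drift
`b_{b̄}(u) = max(−b̄, min(b̄, u))`: comparing the truncated and untruncated linear
dynamics gives `sup_{t∈[0,T]} |x(t)−y(t)| ≤ |κ| e^{|κ|T} ∫₀ᵀ |y(s)| 1_{|y(s)|>b̄} ds`,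
and if `∫₀ᵀ y² ≤ M` then the bound is at most `|κ| e^{|κ|T} M / b̄`. -/
theorem stmt3 (T κ bBar x₀ : ℝ) (hT : 0 < T) (hb : 0 < bBar)
    (g : ℝ → ℝ) (hg : IntegrableOn g (Set.Icc 0 T) volume)
    (w x y : ℝ → ℝ)
    (hx : ContinuousOn x (Set.Icc 0 T)) (hy : ContinuousOn y (Set.Icc 0 T))
    (hxeq : ∀ t ∈ Set.Icc 0 T,
      x t = x₀ + (∫ s in (0:ℝ)..t, (g s + κ * max (-bBar) (min bBar (x s)))) + w t)
    (hyeq : ∀ t ∈ Set.Icc 0 T,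
      y t = x₀ + (∫ s in (0:ℝ)..t, (g s + κ * y s)) + w t) :
    (∀ t ∈ Set.Icc 0 T,
      |x t - y t| ≤ |κ| * Real.exp (|κ| * T) *
        ∫ s in Set.Ioc 0 T, (if bBar < |y s| then |y s| else 0))
    ∧ (∀ M : ℝ, 0 ≤ M → (∫ s in Set.Ioc 0 T, (y s) ^ 2) ≤ M →
        ∀ t ∈ Set.Icc 0 T, |x t - y t| ≤ |κ| * Real.exp (|κ| * T) * M / bBar) := by
  have hmain : ∀ t ∈ Set.Icc 0 T,
      |x t - y t| ≤ |κ| * Real.exp (|κ| * T) *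
        ∫ s in Set.Ioc 0 T, (if bBar < |y s| then |y s| else 0) := by
    set φ : ℝ → ℝ := fun s => if bBar < |y s| then |y s| else 0 with hφ
    have hφ0 : ∀ s, 0 ≤ φ s := fun s => by
      simp only [hφ]; split_ifs <;> simp
    have hφi : IntegrableOn φ (Set.Ioc 0 T) := integrableOn_tail hy
    have hI0 : 0 ≤ ∫ s in Set.Ioc 0 T, φ s := integral_nonneg hφ0
    have hd : ContinuousOn (fun s => |x s - y s|) (Set.Icc 0 T) := (hx.sub hy).abs
    have hc : ContinuousOn (fun s => max (-bBar) (min bBar (x s))) (Set.Icc 0 T) :=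
      continuousOn_const.sup (continuousOn_const.inf hx)
    have hgron : ∀ t ∈ Set.Icc 0 T, |x t - y t| ≤
        |κ| * (∫ s in Set.Ioc 0 T, φ s) + |κ| * ∫ s in (0:ℝ)..t, |x s - y s| := by
      intro t ht
      have hsub : Set.Icc 0 t ⊆ Set.Icc 0 T := Set.Icc_subset_Icc_right ht.2
      have hii {f : ℝ → ℝ} (hf : ContinuousOn f (Set.Icc 0 T)) :
          IntervalIntegrable f volume 0 t := (hf.mono hsub).intervalIntegrable_of_Icc ht.1
      have hgi : IntervalIntegrable g volume 0 t :=
        (intervalIntegrable_iff_integrableOn_Icc_of_le ht.1).2 (hg.mono_set hsub)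
      have hφt : IntervalIntegrable φ volume 0 t :=
        (intervalIntegrable_iff_integrableOn_Ioc_of_le ht.1).2
          (hφi.mono_set (Set.Ioc_subset_Ioc_right ht.2))
      have hdiff : x t - y t =
          κ * ∫ s in (0:ℝ)..t, (max (-bBar) (min bBar (x s)) - y s) := by
        rw [hxeq t ht, hyeq t ht, integral_add hgi ((hii hc).const_mul κ),
          integral_add hgi ((hii hy).const_mul κ), integral_sub (hii hc) (hii hy),
          intervalIntegral.integral_const_mul, intervalIntegral.integral_const_mul]
        ring
      have hle : |∫ s in (0:ℝ)..t, (max (-bBar) (min bBar (x s)) - y s)| ≤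
          (∫ s in (0:ℝ)..t, |x s - y s|) + ∫ s in (0:ℝ)..t, φ s := by
        rw [← integral_add (hii hd) hφt]
        exact (abs_integral_le_integral_abs ht.1).trans <|
          integral_mono_on ht.1 (hii (hc.sub hy).abs) ((hii hd).add hφt)
            fun s _ => abs_clamp_sub_le hb (x s) (y s)
      have hmono : ∫ s in (0:ℝ)..t, φ s ≤ ∫ s in Set.Ioc 0 T, φ s := by
        rw [integral_of_le ht.1]
        exact setIntegral_mono_set hφi (Filter.Eventually.of_forall hφ0)
          (Set.Ioc_subset_Ioc_right ht.2).eventuallyLE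
      rw [hdiff, abs_mul, ← mul_add]
      exact mul_le_mul_of_nonneg_left (by linarith) (abs_nonneg κ)
    intro t ht
    calc |x t - y t|
        ≤ |κ| * (∫ s in Set.Ioc 0 T, φ s) * Real.exp (|κ| * t) :=
          le_mul_exp_of_le_add_mul_integral (abs_nonneg κ) hd hgron t ht
      _ ≤ |κ| * (∫ s in Set.Ioc 0 T, φ s) * Real.exp (|κ| * T) := by
          have := ht.2
          gcongr
      _ = _ := by ring
  refine ⟨hmain, fun M _ hM t ht => (hmain t ht).trans ?_⟩
  have htail : ∫ s in Set.Ioc 0 T, (if bBar < |y s| then |y s| else 0) ≤ M / bBar := by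
    calc ∫ s in Set.Ioc 0 T, (if bBar < |y s| then |y s| else 0)
        ≤ ∫ s in Set.Ioc 0 T, (y s) ^ 2 / bBar := by
          refine integral_mono (integrableOn_tail hy)
            (((hy.pow 2).integrableOn_Icc.mono_set Set.Ioc_subset_Icc_self).div_const bBar)
            fun s => ?_
          dsimp only
          split_ifs with h
          · rw [le_div_iff₀ hb, ← sq_abs]
            nlinarith [abs_nonneg (y s)]
          · positivity
      _ = (∫ s in Set.Ioc 0 T, (y s) ^ 2) / bBar := MeasureTheory.integral_div _ _
      _ ≤ M / bBar := by gcongr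
  rw [mul_div_assoc]
  gcongr
end

section
/- Let (Ω, F, P) be a probability space, let S and T be Polish spaces equipped with their Borel σ-algebras, let ξ : Ω → S and η : Ω → T be measurable, and let g : S → T be Borel measurable. If the pushforward law of ω ↦ (ξ(ω), η(ω)) under P equals the pushforward law of ω ↦ (ξ(ω), g(ξ(ω))) under P, then η = g(ξ) P-almost surely. -/
open MeasureTheory

/-- A random variable whose joint law with `ξ` is that of `(ξ, g(ξ))` equals `g(ξ)` almost surely,
as soon as the diagonal of the target space is measurable. -/
theorem ae_eq_comp_of_map_prodMk_eq {Ω S T : Type*} [MeasurableSpace Ω] [MeasurableSpace S]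
    [MeasurableSpace T] [MeasurableEq T] {μ : Measure Ω} {ξ : Ω → S} {η : Ω → T} {g : S → T}
    (hξ : Measurable ξ) (hη : Measurable η) (hg : Measurable g)
    (h : μ.map (fun ω => (ξ ω, η ω)) = μ.map (fun ω => (ξ ω, g (ξ ω)))) :
    η =ᵐ[μ] g ∘ ξ := by
  have hgraph : MeasurableSet {p : S × T | p.2 = g p.1} :=
    measurableSet_eq_fun measurable_snd (hg.comp measurable_fst)
  have hmap : ∀ᵐ p ∂μ.map (fun ω => (ξ ω, η ω)), p.2 = g p.1 := by
    rw [h]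
    exact (ae_map_iff (hξ.prodMk (hg.comp hξ)).aemeasurable hgraph).mpr (ae_of_all μ fun _ => rfl)
  exact (ae_map_iff (hξ.prodMk hη).aemeasurable hgraph).mp hmap

/-- Graph identification lemma: if the law of `(ξ, η)` equals the law of
`(ξ, g(ξ))` for a Borel map `g` between Polish spaces, then `η = g(ξ)` a.s. -/
theorem stmt7 {Ω S T : Type*} [MeasurableSpace Ω]
    [TopologicalSpace S] [PolishSpace S] [MeasurableSpace S] [BorelSpace S]
    [TopologicalSpace T] [PolishSpace T] [MeasurableSpace T] [BorelSpace T]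
    (P : Measure Ω) [IsProbabilityMeasure P]
    (ξ : Ω → S) (η : Ω → T) (g : S → T)
    (hξ : Measurable ξ) (hη : Measurable η) (hg : Measurable g)
    (h : Measure.map (fun ω => (ξ ω, η ω)) P
        = Measure.map (fun ω => (ξ ω, g (ξ ω))) P) :
    ∀ᵐ ω ∂P, η ω = g (ξ ω) := by
  exact ae_eq_comp_of_map_prodMk_eq hξ hη hg h
end
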